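/- There is an absolute constant C > 0 such that for all real x ≥ 3 and all integers b ≥ 1, J ≥ 1 and 1 ≤ i ≤ J: |Σ_{k ∈ M_i} (1/k) · #{m ∈ M : k | m} − (i/J) · |M| · e^γ · log x| ≤ C · (i/J) · |M| · e^γ · log x · ((log log x)/b + J/(log x)). -/

import Mathlib

open Finset Real

/-- `P x b = ∏_{p ≤ x} p^(b-1)`, product over primes `p ≤ x`. -/
noncomputable def resonatorProd (x : ℝ) (b : ℕ) : ℕ :=
  ∏ p ∈ (Finset.range (⌊x⌋₊ + 1)).filter Nat.Prime, p ^ (b - 1)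

/-- The logarithm of the Euler factor `(1 - 1 / n)⁻¹` at primes `n`, and `0` elsewhere. -/
noncomputable def logEulerFactor (n : ℕ) : ℝ :=
  if n.Prime then -Real.log (1 - (n : ℝ)⁻¹) else 0

lemma le_neg_log_one_sub {t : ℝ} (h1 : t < 1) : t ≤ -Real.log (1 - t) := by
  have := Real.log_le_sub_one_of_pos (sub_pos.2 h1)
  linarith

lemma neg_log_one_sub_le {t : ℝ} (h1 : t < 1) : -Real.log (1 - t) ≤ t / (1 - t) := by
  have h := Real.log_le_sub_one_of_pos (inv_pos.2 (sub_pos.2 h1))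
  rw [Real.log_inv] at h
  have h2 : (1 - t)⁻¹ - 1 = t / (1 - t) := by
    have : 1 - t ≠ 0 := by linarith
    field_simp
    ring
  linarith

lemma Nat.Prime.two_le_cast {p : ℕ} (hp : p.Prime) : (2 : ℝ) ≤ p := by exact_mod_cast hp.two_le

lemma Nat.Prime.inv_le_half {p : ℕ} (hp : p.Prime) : (p : ℝ)⁻¹ ≤ 1 / 2 := by
  rw [one_div]
  exact inv_anti₀ two_pos hp.two_le_cast

lemma logEulerFactor_nonneg (n : ℕ) : 0 ≤ logEulerFactor n := by
  rw [logEulerFactor]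
  split_ifs with h
  · exact (inv_nonneg.2 (Nat.cast_nonneg n)).trans
      (le_neg_log_one_sub (by linarith [h.inv_le_half]))
  · exact le_rfl

lemma inv_le_logEulerFactor {p : ℕ} (hp : p.Prime) : (p : ℝ)⁻¹ ≤ logEulerFactor p := by
  rw [logEulerFactor, if_pos hp]
  exact le_neg_log_one_sub (by linarith [hp.inv_le_half])

lemma logEulerFactor_le {p : ℕ} (hp : p.Prime) : logEulerFactor p ≤ 1 / ((p : ℝ) - 1) := by
  rw [logEulerFactor, if_pos hp]
  have h2 := hp.two_le_cast
  refine (neg_log_one_sub_le (by linarith [hp.inv_le_half])).trans_eq ?_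
  have : (p : ℝ) - 1 ≠ 0 := by linarith
  have : (p : ℝ) ≠ 0 := by linarith
  field_simp

lemma log_factorial_eq_sum (n : ℕ) :
    Real.log (n.factorial : ℝ) =
      ∑ p ∈ n.primesLE, (n.factorial.factorization p : ℝ) * Real.log p := by
  rw [Real.log_nat_eq_sum_factorization, Finsupp.sum]
  refine Finset.sum_subset ?_ ?_
  · intro p hp
    rw [Nat.support_factorization, Nat.mem_primeFactors] at hp
    exact Nat.mem_primesLE.2 ⟨(hp.1.dvd_factorial).1 hp.2.1, hp.1⟩
  · intro p _ hp
    rw [Finsupp.notMem_support_iff] at hp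
    simp [hp]

lemma div_sub_one_le_factorization_factorial {p : ℕ} (hp : p.Prime) (n : ℕ) :
    (n : ℝ) / p - 1 ≤ n.factorial.factorization p := by
  have := Fact.mk hp
  have h : n / p ≤ n.factorial.factorization p := by
    rw [Nat.factorization_def _ hp, padicValNat_factorial (b := Nat.log p n + 2) (by omega)]
    have := Finset.single_le_sum (f := fun i ↦ n / p ^ i) (fun i _ ↦ Nat.zero_le _)
      (show 1 ∈ Finset.Ico 1 (Nat.log p n + 2) by simp)
    simpa using this
  have h2 : (n : ℝ) / p < (n / p : ℕ) + 1 := by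
    rw [← Nat.floor_div_eq_div (K := ℝ)]
    exact Nat.lt_floor_add_one _
  have h3 : ((n / p : ℕ) : ℝ) ≤ n.factorial.factorization p := by exact_mod_cast h
  linarith

lemma factorization_factorial_le_div {p : ℕ} (hp : p.Prime) (n : ℕ) :
    (n.factorial.factorization p : ℝ) ≤ n / ((p : ℝ) - 1) := by
  have := Fact.mk hp
  have h2 := hp.two_le_cast
  rw [le_div_iff₀ (by linarith), Nat.factorization_def _ hp]
  have h : (p - 1) * padicValNat p n.factorial ≤ n := by
    rw [sub_one_mul_padicValNat_factorial]
    exact Nat.sub_le _ _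
  have h' : (((p - 1) * padicValNat p n.factorial : ℕ) : ℝ) ≤ n := by exact_mod_cast h
  rw [Nat.cast_mul, Nat.cast_sub hp.one_le, Nat.cast_one] at h'
  linarith

lemma summable_log_div_mul_sub_one :
    Summable fun n : ℕ ↦ Real.log n / ((n : ℝ) * (n - 1)) := by
  have hs : Summable fun n : ℕ ↦ 4 * (n : ℝ) ^ (-(3 / 2) : ℝ) :=
    (Real.summable_nat_rpow.2 (by norm_num)).mul_left 4
  refine Summable.of_nonneg_of_le ?_ ?_ hs
  · intro n
    rcases Nat.eq_zero_or_pos n with rfl | hn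
    · simp
    have : (1 : ℝ) ≤ n := by exact_mod_cast hn
    exact div_nonneg (Real.log_nonneg this) (mul_nonneg (by linarith) (by linarith))
  · intro n
    rcases lt_or_ge n 2 with hn | hn
    · interval_cases n <;> simp
    have h2 : (2 : ℝ) ≤ n := by exact_mod_cast hn
    have h0 : (0 : ℝ) < n := by linarith
    rw [div_le_iff₀ (mul_pos h0 (by linarith))]
    have h := Real.log_le_rpow_div h0.le (show (0 : ℝ) < 1 / 2 by norm_num)
    have e : (n : ℝ) ^ (1 / 2 : ℝ) = (n : ℝ) ^ (-(3 / 2) : ℝ) * ((n : ℝ) * n) := by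
      rw [← pow_two, ← Real.rpow_natCast, ← Real.rpow_add h0]
      norm_num
    have hp : 0 < (n : ℝ) ^ (-(3 / 2) : ℝ) := Real.rpow_pos_of_pos h0 _
    rw [e] at h
    nlinarith [mul_pos hp h0, mul_nonneg (mul_pos hp h0).le (sub_nonneg.2 h2)]

lemma exists_abs_sum_logEulerFactor_mul_log_sub_log_le :
    ∃ K : ℝ, ∀ n : ℕ, 1 ≤ n →
      |∑ k ∈ range (n + 1), logEulerFactor k * Real.log k - Real.log n| ≤ K := by
  set T := ∑' n : ℕ, Real.log n / ((n : ℝ) * (n - 1)) with hT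
  refine ⟨Real.log 4 + T + 1, fun n hn ↦ ?_⟩
  have hn0 : (0 : ℝ) < n := by exact_mod_cast hn
  have hsum : ∑ k ∈ range (n + 1), logEulerFactor k * Real.log k =
      ∑ p ∈ n.primesLE, logEulerFactor p * Real.log p := by
    rw [Nat.primesLE_eq_filter_range, Finset.sum_filter]
    refine Finset.sum_congr rfl fun k _ ↦ ?_
    split_ifs with h
    · rfl
    · simp [logEulerFactor, h]
  have hTn : ∑ p ∈ n.primesLE, Real.log p / ((p : ℝ) * (p - 1)) ≤ T := by
    refine summable_log_div_mul_sub_one.sum_le_tsum _ fun m _ ↦ ?_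
    rcases Nat.eq_zero_or_pos m with rfl | hm
    · simp
    have : (1 : ℝ) ≤ m := by exact_mod_cast hm
    exact div_nonneg (Real.log_nonneg this) (mul_nonneg (by linarith) (by linarith))
  have hθ : ∑ p ∈ n.primesLE, Real.log p ≤ Real.log 4 * n := by
    rw [← Chebyshev.theta_eq_sum_primesLE_log]
    exact Chebyshev.theta_le_log4_mul_x hn0.le
  have key : |n * ∑ p ∈ n.primesLE, logEulerFactor p * Real.log p - Real.log n.factorial| ≤
      (Real.log 4 + T) * n := by
    rw [log_factorial_eq_sum, Finset.mul_sum, ← Finset.sum_sub_distrib]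
    refine (Finset.abs_sum_le_sum_abs _ _).trans ?_
    calc _ ≤ ∑ p ∈ n.primesLE, (Real.log p + n * (Real.log p / ((p : ℝ) * (p - 1)))) := by
          refine Finset.sum_le_sum fun p hp ↦ ?_
          have hp := Nat.prime_of_mem_primesLE hp
          have h2 := hp.two_le_cast
          have hl : 0 ≤ Real.log p := Real.log_nonneg (by linarith)
          have e : (n : ℝ) * logEulerFactor p * Real.log p -
              n.factorial.factorization p * Real.log p
            = (n * logEulerFactor p - n.factorial.factorization p) * Real.log p := by ring
          have e2 : Real.log p + n * (Real.log p / ((p : ℝ) * (p - 1))) =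
            (1 + n * (1 / ((p : ℝ) - 1) - (p : ℝ)⁻¹)) * Real.log p := by
            have : (p : ℝ) - 1 ≠ 0 := by linarith
            have : (p : ℝ) ≠ 0 := by linarith
            field_simp
            ring
          rw [← mul_assoc, e, e2, abs_mul, abs_of_nonneg hl]
          refine mul_le_mul_of_nonneg_right ?_ hl
          have b1 := mul_le_mul_of_nonneg_left (inv_le_logEulerFactor hp) hn0.le
          have b2 := mul_le_mul_of_nonneg_left (logEulerFactor_le hp) hn0.le
          have b3 := div_sub_one_le_factorization_factorial hp n
          have b4 := factorization_factorial_le_div hp n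
          rw [div_eq_mul_inv] at b3
          rw [div_eq_mul_one_div] at b4
          rw [abs_le]
          constructor <;> linarith
      _ ≤ _ := by
          rw [Finset.sum_add_distrib, ← Finset.mul_sum]
          nlinarith [mul_le_mul_of_nonneg_left hTn hn0.le]
  have hf1 : n * Real.log n - n ≤ Real.log n.factorial := by
    have h := Stirling.le_log_factorial_stirling (n := n) (by omega)
    have h1 : 0 ≤ Real.log n := Real.log_nonneg (by exact_mod_cast hn)
    have h2 : 0 ≤ Real.log (2 * π) := Real.log_nonneg (by linarith [Real.pi_gt_three])
    linarith
  have hf2 : Real.log n.factorial ≤ n * Real.log n := by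
    rw [← Real.log_pow]
    refine Real.log_le_log (by exact_mod_cast n.factorial_pos) ?_
    exact_mod_cast n.factorial_le_pow
  rw [hsum]
  set S := ∑ p ∈ n.primesLE, logEulerFactor p * Real.log p
  rw [abs_le] at key ⊢
  constructor
  · refine le_of_mul_le_mul_left ?_ hn0
    linarith
  · refine le_of_mul_le_mul_left ?_ hn0
    linarith

lemma exists_forall_abs_sub_le_of_abs_succ_sub_le {g h : ℕ → ℝ} (N : ℕ)
    (hgh : ∀ n, N ≤ n → |g (n + 1) - g n| ≤ h n - h (n + 1))
    (hh : Filter.Tendsto h Filter.atTop (nhds 0)) :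
    ∃ B, ∀ n, N ≤ n → |g n - B| ≤ h n := by
  have key : ∀ n, N ≤ n → ∀ m, |g (n + m) - g n| ≤ h n - h (n + m) := by
    intro n hn m
    induction m with
    | zero => simp
    | succ m ih =>
      have h1 := hgh (n + m) (by omega)
      have h2 := abs_sub_le (g (n + m + 1)) (g (n + m)) (g n)
      rw [← add_assoc]
      linarith
  have hc : CauchySeq g := by
    rw [Metric.cauchySeq_iff']
    intro ε hε
    obtain ⟨m, hm⟩ := ((hh.eventually (Metric.ball_mem_nhds 0 (half_pos hε))).and
      (Filter.eventually_ge_atTop N)).exists_forall_of_atTop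
    refine ⟨m, fun n hn ↦ ?_⟩
    obtain ⟨k, rfl⟩ := Nat.exists_eq_add_of_le hn
    have h1 := (hm m le_rfl).1
    have h2 := (hm _ hn).1
    have h3 := key m (hm m le_rfl).2 k
    rw [Real.dist_eq, sub_zero, abs_lt] at h1 h2
    rw [Real.dist_eq]
    linarith
  obtain ⟨B, hB⟩ := cauchySeq_tendsto_of_complete hc
  refine ⟨B, fun n hn ↦ ?_⟩
  have l1 : Filter.Tendsto (fun m ↦ |g (n + m) - g n|) Filter.atTop (nhds |B - g n|) :=
    ((hB.comp (Filter.tendsto_add_atTop_nat n)).congr (fun m ↦ by simp [add_comm])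
      |>.sub_const _).abs
  have l2 : Filter.Tendsto (fun m ↦ h n - h (n + m)) Filter.atTop (nhds (h n - 0)) :=
    ((hh.comp (Filter.tendsto_add_atTop_nat n)).congr (fun m ↦ by simp [add_comm])).const_sub _
  rw [abs_sub_comm, ← sub_zero (h n)]
  exact le_of_tendsto_of_tendsto' l1 l2 (key n hn)

lemma tendsto_log_natCast_atTop :
    Filter.Tendsto (fun n : ℕ ↦ Real.log n) Filter.atTop Filter.atTop :=
  Real.tendsto_log_atTop.comp tendsto_natCast_atTop_atTop

lemma exists_abs_sum_sub_log_log_sub_le {a : ℕ → ℝ} {K : ℝ}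
    (ha : ∀ n : ℕ, 1 ≤ n → |∑ k ∈ range (n + 1), a k * Real.log k - Real.log n| ≤ K) :
    ∃ B : ℝ, ∀ n : ℕ, 2 ≤ n →
      |∑ k ∈ range (n + 1), a k - Real.log (Real.log n) - B| ≤ (2 * K + 1) / Real.log n := by
  set E : ℕ → ℝ := fun n ↦ ∑ k ∈ range (n + 1), a k * Real.log k - Real.log n with hE
  have hlim : Filter.Tendsto (fun n : ℕ ↦ (K + 1) / Real.log n) Filter.atTop (nhds 0) :=
    Filter.Tendsto.const_div_atTop tendsto_log_natCast_atTop _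
  have hstep : ∀ n, 2 ≤ n → |(∑ k ∈ range (n + 1 + 1), a k - Real.log (Real.log (n + 1 : ℕ)) -
      E (n + 1) / Real.log (n + 1 : ℕ)) -
      (∑ k ∈ range (n + 1), a k - Real.log (Real.log n) - E n / Real.log n)| ≤
      (K + 1) / Real.log n - (K + 1) / Real.log (n + 1 : ℕ) := by
    intro n hn
    have hn0 : (0 : ℝ) < n := by exact_mod_cast (by omega : 0 < n)
    have hl : 0 < Real.log n := Real.log_pos (by exact_mod_cast hn)
    have hlt : Real.log n < Real.log (n + 1 : ℕ) :=
      Real.log_lt_log hn0 (by push_cast; linarith)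
    have hd : Real.log (n + 1 : ℕ) - Real.log n ≤ 1 := by
      rw [← Real.log_div (by positivity) hn0.ne']
      refine (Real.log_le_sub_one_of_pos (by positivity)).trans ?_
      rw [sub_le_iff_le_add, div_le_iff₀ hn0]
      have : (1 : ℝ) ≤ n := by exact_mod_cast (by omega : 1 ≤ n)
      push_cast
      linarith
    have hEs : E (n + 1) = E n + a (n + 1) * Real.log (n + 1 : ℕ) -
        (Real.log (n + 1 : ℕ) - Real.log n) := by
      simp only [hE]
      rw [Finset.sum_range_succ _ (n + 1)]
      ring
    have hK := ha n (by omega)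
    change |E n| ≤ K at hK
    rw [hEs, Finset.sum_range_succ _ (n + 1)]
    set p := Real.log n
    set q := Real.log (n + 1 : ℕ)
    have hq : 0 < q := hl.trans hlt
    set S := ∑ k ∈ range (n + 1), a k
    set L := Real.log q - Real.log p with hL
    have hL' : L = Real.log (q / p) := by rw [Real.log_div hq.ne' hl.ne']
    have hL1 : L ≤ q / p - 1 := by
      rw [hL']
      exact Real.log_le_sub_one_of_pos (div_pos hq hl)
    have hL2 : 1 - p / q ≤ L := by
      have := Real.one_sub_inv_le_log_of_pos (div_pos hq hl)
      rwa [inv_div, ← hL'] at this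
    have e : S + a (n + 1) - Real.log q - (E n + a (n + 1) * q - (q - p)) / q -
        (S - Real.log p - E n / p) = E n * (1 / p - 1 / q) - (L - (1 - p / q)) := by
      rw [hL]
      field_simp
      ring
    have e3 : (K + 1) / p - (K + 1) / q = K * (1 / p - 1 / q) + (1 / p - 1 / q) := by ring
    have hpq : 0 ≤ 1 / p - 1 / q := sub_nonneg.2 (one_div_le_one_div_of_le hl hlt.le)
    have h4 : L - (1 - p / q) ≤ 1 / p - 1 / q := by
      have : q / p - 1 - (1 - p / q) = (q - p) * ((q - p) * (1 / (p * q))) := by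
        field_simp
      have h5 : 1 / p - 1 / q = (q - p) * (1 / (p * q)) := by field_simp
      have h6 : (q - p) * ((q - p) * (1 / (p * q))) ≤ 1 * ((q - p) * (1 / (p * q))) :=
        mul_le_mul_of_nonneg_right hd (h5 ▸ hpq)
      linarith
    rw [e, e3]
    have h7 : |E n * (1 / p - 1 / q)| ≤ K * (1 / p - 1 / q) := by
      rw [abs_mul, abs_of_nonneg hpq]
      exact mul_le_mul_of_nonneg_right hK hpq
    rw [abs_le] at h7 ⊢
    constructor <;> linarith
  obtain ⟨B, hB⟩ := exists_forall_abs_sub_le_of_abs_succ_sub_le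
    (g := fun n ↦ ∑ k ∈ range (n + 1), a k - Real.log (Real.log n) - E n / Real.log n)
    (h := fun n ↦ (K + 1) / Real.log n) 2 hstep hlim
  refine ⟨B, fun n hn ↦ ?_⟩
  have hl : 0 < Real.log n := Real.log_pos (by exact_mod_cast hn)
  have h1 := hB n hn
  have h2 : |E n / Real.log n| ≤ K / Real.log n := by
    rw [abs_div, abs_of_pos hl]
    exact div_le_div_of_nonneg_right (ha n (by omega)) hl.le
  have e : (2 * K + 1) / Real.log n = (K + 1) / Real.log n + K / Real.log n := by ring
  rw [e]
  rw [abs_le] at *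
  constructor <;> linarith

open MeasureTheory Filter in
lemma integral_tsum_ite_le_mul_exp_neg {ι : Type*} [Countable ι] {a l : ι → ℝ} {ε : ℝ}
    (hε : 0 < ε) (ha : ∀ i, 0 ≤ a i) (hl : ∀ i, 0 ≤ l i)
    (hs : Summable fun i ↦ a i * Real.exp (-(ε * l i))) :
    ∫ v in Set.Ici (0 : ℝ), (∑' i, if l i ≤ v / ε then a i else 0) * Real.exp (-v) =
      ∑' i, a i * Real.exp (-(ε * l i)) := by
  set F : ι → ℝ → ℝ := fun i ↦ (Set.Ici (ε * l i)).indicator fun v ↦ a i * Real.exp (-v) with hF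
  have hint (i : ι) : ∫ v in Set.Ici (0 : ℝ), F i v = a i * Real.exp (-(ε * l i)) := by
    rw [hF, setIntegral_indicator measurableSet_Ici,
      Set.inter_eq_right.2 (Set.Ici_subset_Ici.2 (mul_nonneg hε.le (hl i))),
      integral_Ici_eq_integral_Ioi, integral_const_mul, integral_exp_neg_Ioi]
  have hnorm (i : ι) (v : ℝ) : ‖F i v‖ = F i v := by
    refine Real.norm_of_nonneg (Set.indicator_nonneg (fun v _ ↦ ?_) v)
    exact mul_nonneg (ha i) (Real.exp_pos _).le
  have hi (i : ι) : Integrable (F i) (volume.restrict (Set.Ici 0)) := by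
    refine Integrable.indicator ?_ measurableSet_Ici
    refine Integrable.const_mul ?_ _
    exact (integrableOn_Ici_iff_integrableOn_Ioi).2 (integrableOn_exp_neg_Ioi 0)
  have h := hasSum_integral_of_summable_integral_norm hi (by simpa only [hnorm, hint] using hs)
  simp only [hint] at h
  rw [h.tsum_eq]
  refine integral_congr_ae (Filter.Eventually.of_forall fun v ↦ ?_)
  simp only [hF]
  rw [← tsum_mul_right]
  refine tsum_congr fun i ↦ ?_
  simp only [Set.indicator_apply, Set.mem_Ici, le_div_iff₀ hε, mul_comm ε]
  split_ifs <;> simp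

open MeasureTheory Filter in
lemma tendsto_integral_comp_div_mul_exp_neg {D : ℝ → ℝ} {c M : ℝ} (hm : Measurable D)
    (hM : ∀ u, 0 ≤ u → |D u| ≤ M) (hD : Tendsto D atTop (nhds c)) :
    Tendsto (fun ε : ℝ ↦ ∫ v in Set.Ici (0 : ℝ), D (v / ε) * Real.exp (-v))
      (nhdsWithin 0 (Set.Ioi 0)) (nhds c) := by
  simp only [integral_Ici_eq_integral_Ioi]
  have hc : ∫ v in Set.Ioi (0 : ℝ), c * Real.exp (-v) = c := by
    rw [integral_const_mul, integral_exp_neg_Ioi_zero, mul_one]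
  suffices h : Tendsto (fun ε : ℝ ↦ ∫ v in Set.Ioi (0 : ℝ), D (v / ε) * Real.exp (-v))
      (nhdsWithin 0 (Set.Ioi 0)) (nhds (∫ v in Set.Ioi (0 : ℝ), c * Real.exp (-v))) by rwa [hc] at h
  refine tendsto_integral_filter_of_dominated_convergence (fun v ↦ M * Real.exp (-v)) ?_ ?_ ?_ ?_
  · refine Eventually.of_forall fun ε ↦ Measurable.aestronglyMeasurable ?_
    exact (hm.comp (measurable_id.div_const ε)).mul (by fun_prop)
  · filter_upwards [self_mem_nhdsWithin] with ε hε
    filter_upwards [ae_restrict_mem measurableSet_Ioi] with v hv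
    rw [norm_mul, Real.norm_eq_abs, Real.norm_of_nonneg (Real.exp_pos _).le]
    exact mul_le_mul_of_nonneg_right (hM _ (div_nonneg (le_of_lt hv) (le_of_lt hε)))
      (Real.exp_pos _).le
  · exact (integrableOn_exp_neg_Ioi 0).const_mul M
  · filter_upwards [ae_restrict_mem measurableSet_Ioi] with v hv
    have h : Tendsto (fun ε : ℝ ↦ v / ε) (nhdsWithin 0 (Set.Ioi 0)) atTop := by
      simpa only [div_eq_mul_inv] using tendsto_inv_nhdsGT_zero.const_mul_atTop hv
    exact (hD.comp h).mul_const _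

lemma inv_mul_exp_neg_mul_log_eq_rpow {ε : ℝ} (hε : 0 < ε) (n : ℕ) :
    (n : ℝ)⁻¹ * Real.exp (-(ε * Real.log n)) = (n : ℝ) ^ (-(1 + ε)) := by
  rcases Nat.eq_zero_or_pos n with rfl | hn
  · rw [Nat.cast_zero, Real.zero_rpow (by linarith)]
    simp
  · have h : (0 : ℝ) < n := by exact_mod_cast hn
    rw [neg_add, Real.rpow_add h, Real.rpow_neg_one, Real.rpow_def_of_pos h]
    congr 2
    ring

lemma exp_neg_mul_log_natCast_le_one {ε : ℝ} (hε : 0 < ε) (n : ℕ) :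
    Real.exp (-(ε * Real.log n)) ≤ 1 := by
  rw [Real.exp_le_one_iff, neg_nonpos]
  exact mul_nonneg hε.le (Real.log_natCast_nonneg n)

lemma summable_inv_mul_exp_neg_mul_log {ε : ℝ} (hε : 0 < ε) :
    Summable fun n : ℕ ↦ (n : ℝ)⁻¹ * Real.exp (-(ε * Real.log n)) := by
  simp only [inv_mul_exp_neg_mul_log_eq_rpow hε]
  exact Real.summable_nat_rpow.2 (by linarith)

lemma neg_log_one_sub_le_add_sq {t : ℝ} (h1 : t ≤ 1 / 2) :
    -Real.log (1 - t) ≤ t + 2 * t ^ 2 := by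
  refine (neg_log_one_sub_le (by linarith)).trans ?_
  rw [div_le_iff₀ (by linarith)]
  nlinarith [mul_nonneg (sq_nonneg t) (sub_nonneg.2 h1)]

lemma logEulerFactor_le_two_mul_inv (n : ℕ) : logEulerFactor n ≤ 2 * (n : ℝ)⁻¹ := by
  rw [logEulerFactor]
  split_ifs with h
  · have h0 : 0 ≤ (n : ℝ)⁻¹ := by positivity
    nlinarith [neg_log_one_sub_le_add_sq h.inv_le_half, h.inv_le_half]
  · positivity

lemma summable_logEulerFactor_mul_exp {ε : ℝ} (hε : 0 < ε) :
    Summable fun n : ℕ ↦ logEulerFactor n * Real.exp (-(ε * Real.log n)) := by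
  refine Summable.of_nonneg_of_le (fun n ↦ mul_nonneg (logEulerFactor_nonneg n)
    (Real.exp_pos _).le) (fun n ↦ ?_) ((summable_inv_mul_exp_neg_mul_log hε).mul_left 2)
  rw [← mul_assoc]
  exact mul_le_mul_of_nonneg_right (logEulerFactor_le_two_mul_inv n) (Real.exp_pos _).le

/-- The logarithm of the Euler factor of `ζ (1 + ε)` at primes `n`, and `0` elsewhere. -/
noncomputable def logZetaFactor (ε : ℝ) (n : ℕ) : ℝ :=
  if n.Prime then -Real.log (1 - (n : ℝ)⁻¹ * Real.exp (-(ε * Real.log n))) else 0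

lemma summable_logZetaFactor {ε : ℝ} (hε : 0 < ε) : Summable (logZetaFactor ε) := by
  have key (n : ℕ) (h : n.Prime) : 0 ≤ (n : ℝ)⁻¹ * Real.exp (-(ε * Real.log n)) ∧
      (n : ℝ)⁻¹ * Real.exp (-(ε * Real.log n)) ≤ 1 / 2 := by
    have h0 : 0 ≤ (n : ℝ)⁻¹ := by positivity
    refine ⟨by positivity, le_trans ?_ h.inv_le_half⟩
    exact mul_le_of_le_one_right h0 (exp_neg_mul_log_natCast_le_one hε n)
  refine Summable.of_nonneg_of_le (fun n ↦ ?_) (fun n ↦ ?_)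
    ((summable_inv_mul_exp_neg_mul_log hε).mul_left 2)
  · rw [logZetaFactor]
    split_ifs with h
    · exact (key n h).1.trans (le_neg_log_one_sub (by linarith [(key n h).2]))
    · exact le_rfl
  · rw [logZetaFactor]
    split_ifs with h
    · nlinarith [neg_log_one_sub_le_add_sq (key n h).2, (key n h).1, (key n h).2]
    · positivity

lemma exp_tsum_logZetaFactor {ε : ℝ} (hε : 0 < ε) :
    Real.exp (∑' n, logZetaFactor ε n) = ∑' n : ℕ, 1 / (n : ℝ) ^ (1 + ε) := by
  let f : ℕ →*₀ ℝ :=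
    { toFun := fun n ↦ (n : ℝ) ^ (-(1 + ε))
      map_zero' := by rw [Nat.cast_zero, Real.zero_rpow (by linarith)]
      map_one' := by simp
      map_mul' := fun m n ↦ by
        rw [Nat.cast_mul, Real.mul_rpow (Nat.cast_nonneg m) (Nat.cast_nonneg n)] }
  have hf (n : ℕ) : f n = (n : ℝ) ^ (-(1 + ε)) := rfl
  have hsum : Summable (fun n ↦ ‖f n‖) := by
    simp only [hf, Real.norm_of_nonneg (Real.rpow_nonneg (Nat.cast_nonneg _) _)]
    exact Real.summable_nat_rpow.2 (by linarith)
  have h1 := EulerProduct.eulerProduct_completely_multiplicative_hasProd hsum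
  have h2 : HasSum (fun p : Nat.Primes ↦ logZetaFactor ε p) (∑' n, logZetaFactor ε n) := by
    refine (hasSum_subtype_iff_of_support_subset (s := {n : ℕ | n.Prime}) ?_).2
      (summable_logZetaFactor hε).hasSum
    intro n hn
    by_contra h
    exact hn (if_neg h)
  have h3 : HasProd (fun p : Nat.Primes ↦ (1 - f p)⁻¹) (Real.exp (∑' n, logZetaFactor ε n)) := by
    convert h2.rexp using 2 with p
    have hp := p.2
    rw [Function.comp_apply, logZetaFactor, if_pos hp, inv_mul_exp_neg_mul_log_eq_rpow hε,
      Real.exp_neg, Real.exp_log, hf]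
    rw [sub_pos]
    exact Real.rpow_lt_one_of_one_lt_of_neg (by exact_mod_cast hp.one_lt) (by linarith)
  rw [h3.unique h1]
  refine tsum_congr fun n ↦ ?_
  rw [hf, Real.rpow_neg (Nat.cast_nonneg n), one_div]

open Filter in
lemma tendsto_tsum_logEulerFactor_add_log :
    Tendsto (fun ε : ℝ ↦ ∑' n, logEulerFactor n * Real.exp (-(ε * Real.log n)) + Real.log ε)
      (nhdsWithin 0 (Set.Ioi 0)) (nhds 0) := by
  have h1 : Tendsto (fun ε : ℝ ↦ ∑' n, logZetaFactor ε n + Real.log ε)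
      (nhdsWithin 0 (Set.Ioi 0)) (nhds 0) := by
    have ht : Tendsto (fun ε : ℝ ↦ 1 + ε) (nhdsWithin 0 (Set.Ioi 0))
        (nhdsWithin 1 (Set.Ioi 1)) := by
      refine tendsto_nhdsWithin_iff.2 ⟨?_, ?_⟩
      · have : Tendsto (fun ε : ℝ ↦ 1 + ε) (nhds 0) (nhds (1 + 0)) := tendsto_id.const_add 1
        rw [add_zero] at this
        exact this.mono_left nhdsWithin_le_nhds
      · filter_upwards [self_mem_nhdsWithin] with ε (hε : 0 < ε)
        exact lt_add_of_pos_right 1 hε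
    have h := (tendsto_sub_mul_tsum_nat_rpow.comp ht).log one_ne_zero
    rw [Real.log_one] at h
    refine h.congr' ?_
    filter_upwards [self_mem_nhdsWithin] with ε (hε : 0 < ε)
    simp only [Function.comp_apply]
    rw [← exp_tsum_logZetaFactor hε, add_sub_cancel_left,
      Real.log_mul hε.ne' (Real.exp_pos _).ne', Real.log_exp, add_comm]
  have h2 : Tendsto (fun ε : ℝ ↦ ∑' n, (logZetaFactor ε n -
      logEulerFactor n * Real.exp (-(ε * Real.log n))))
      (nhdsWithin 0 (Set.Ioi 0)) (nhds (∑' _ : ℕ, (0 : ℝ))) := by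
    refine tendsto_tsum_of_dominated_convergence (bound := fun n : ℕ ↦ 2 * ((n : ℝ) ^ 2)⁻¹)
      ((Real.summable_nat_pow_inv.2 one_lt_two).mul_left 2) (fun n ↦ ?_) ?_
    · refine Tendsto.mono_left ?_ nhdsWithin_le_nhds
      have hexp : Tendsto (fun ε : ℝ ↦ Real.exp (-(ε * Real.log n))) (nhds 0) (nhds 1) := by
        have : Continuous fun ε : ℝ ↦ Real.exp (-(ε * Real.log n)) := by fun_prop
        simpa using this.tendsto 0
      by_cases hn : n.Prime
      · have hpos : 1 - (n : ℝ)⁻¹ * 1 ≠ 0 := by linarith [hn.inv_le_half]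
        have := ((hexp.const_mul (n : ℝ)⁻¹).const_sub 1).log hpos
        have := this.neg.sub (hexp.const_mul (logEulerFactor n))
        simpa [logZetaFactor, logEulerFactor, hn] using this
      · simp [logZetaFactor, logEulerFactor, hn]
    · filter_upwards [self_mem_nhdsWithin] with ε (hε : 0 < ε) n
      by_cases hn : n.Prime
      · rw [logZetaFactor, logEulerFactor, if_pos hn, if_pos hn, Real.norm_eq_abs, ← inv_pow]
        have hw1 := exp_neg_mul_log_natCast_le_one hε n
        have hw0 := Real.exp_pos (-(ε * Real.log n))
        have ht1 := hn.inv_le_half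
        have ht0 : 0 ≤ (n : ℝ)⁻¹ := by positivity
        set t := (n : ℝ)⁻¹
        set w := Real.exp (-(ε * Real.log n))
        have htw : t * w ≤ t := mul_le_of_le_one_right ht0 hw1
        have htw0 : 0 ≤ t * w := mul_nonneg ht0 hw0.le
        have hsq : (t * w) ^ 2 ≤ t ^ 2 := pow_le_pow_left₀ htw0 htw 2
        have hsq' : t ^ 2 * w ≤ t ^ 2 := mul_le_of_le_one_right (sq_nonneg t) hw1
        have a1 := le_neg_log_one_sub (show t * w < 1 by linarith)
        have a2 := neg_log_one_sub_le_add_sq (htw.trans ht1)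
        have a3 := mul_le_mul_of_nonneg_right (le_neg_log_one_sub (show t < 1 by linarith)) hw0.le
        have a4 := mul_le_mul_of_nonneg_right (neg_log_one_sub_le_add_sq ht1) hw0.le
        rw [abs_le]
        constructor <;> linarith
      · rw [logZetaFactor, logEulerFactor, if_neg hn, if_neg hn]
        simp
  rw [tsum_zero] at h2
  have h3 := h1.sub h2
  rw [sub_zero] at h3
  refine h3.congr' ?_
  filter_upwards [self_mem_nhdsWithin] with ε (hε : 0 < ε)
  rw [(summable_logZetaFactor hε).tsum_sub (summable_logEulerFactor_mul_exp hε)]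
  ring

lemma hasSum_inv_succ_mul_exp {ε : ℝ} (hε : 0 < ε) :
    HasSum (fun n : ℕ ↦ ((n : ℝ) + 1)⁻¹ * Real.exp (-(ε * ((n : ℝ) + 1))))
      (-Real.log (1 - Real.exp (-ε))) := by
  have h := Real.hasSum_pow_div_log_of_abs_lt_one (x := Real.exp (-ε))
    (by rw [abs_of_pos (Real.exp_pos _)]; simpa using hε)
  convert h using 2 with n
  rw [← Real.exp_nat_mul, div_eq_inv_mul]
  congr 2
  push_cast
  ring

open Filter in
lemma tendsto_neg_log_one_sub_exp_neg_add_log :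
    Tendsto (fun ε : ℝ ↦ -Real.log (1 - Real.exp (-ε)) + Real.log ε)
      (nhdsWithin 0 (Set.Ioi 0)) (nhds 0) := by
  have hd : HasDerivAt (fun ε : ℝ ↦ 1 - Real.exp (-ε)) 1 0 := by
    simpa using ((hasDerivAt_neg (0 : ℝ)).exp).const_sub 1
  have h := hd.tendsto_slope_zero_right.log one_ne_zero
  have h := h.neg
  rw [Real.log_one, neg_zero] at h
  refine h.congr' ?_
  filter_upwards [self_mem_nhdsWithin] with ε (hε : 0 < ε)
  have h1 : 1 - Real.exp (-ε) ≠ 0 := by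
    have : Real.exp (-ε) < 1 := by simpa using hε
    linarith
  simp only [zero_add, Real.exp_zero, sub_self, sub_zero, smul_eq_mul]
  rw [Real.log_mul (inv_ne_zero hε.ne') h1, Real.log_inv]
  ring

open Filter in
lemma tendsto_log_floor_sub_log :
    Tendsto (fun u : ℝ ↦ Real.log ⌊u⌋₊ - Real.log u) atTop (nhds 0) := by
  have h := (tendsto_nat_floor_div_atTop (R := ℝ)).log one_ne_zero
  rw [Real.log_one] at h
  refine h.congr' ?_
  filter_upwards [eventually_ge_atTop 1] with u hu
  have h1 : (0 : ℝ) < ⌊u⌋₊ := by exact_mod_cast Nat.floor_pos.2 hu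
  rw [Real.log_div h1.ne' (by linarith)]

open Filter in
lemma tendsto_log_log_floor_exp_sub_log :
    Tendsto (fun u : ℝ ↦ Real.log (Real.log ⌊Real.exp u⌋₊) - Real.log u) atTop (nhds 0) := by
  have h1 : Tendsto (fun u : ℝ ↦ Real.log ⌊Real.exp u⌋₊ - u) atTop (nhds 0) := by
    refine (tendsto_log_floor_sub_log.comp Real.tendsto_exp_atTop).congr fun u ↦ ?_
    simp
  have h2 : Tendsto (fun u : ℝ ↦ 1 + (Real.log ⌊Real.exp u⌋₊ - u) * u⁻¹) atTop
      (nhds (1 + 0 * 0)) := (h1.mul tendsto_inv_atTop_zero).const_add 1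
  have h3 := h2.log (by norm_num)
  rw [mul_zero, add_zero, Real.log_one] at h3
  refine h3.congr' ?_
  filter_upwards [eventually_ge_atTop 1, Real.tendsto_exp_atTop.eventually_ge_atTop 2] with u hu hu2
  have h4 : (2 : ℝ) ≤ ⌊Real.exp u⌋₊ := by exact_mod_cast Nat.le_floor (by exact_mod_cast hu2)
  have h5 : 0 < Real.log ⌊Real.exp u⌋₊ := Real.log_pos (by linarith)
  rw [← Real.log_div h5.ne' (by linarith)]
  congr 1
  have : u ≠ 0 := by linarith
  field_simp
  ring

open Filter in
lemma exists_abs_sub_le_of_monotone_of_tendsto {F G : ℝ → ℝ} {c : ℝ} (hF : Monotone F)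
    (hG : Monotone G) (hF0 : ∀ u, 0 ≤ F u) (hG0 : ∀ u, 0 ≤ G u)
    (h : Tendsto (fun u ↦ F u - G u) atTop (nhds c)) : ∃ M, ∀ u, |F u - G u| ≤ M := by
  obtain ⟨U, hU⟩ := (h.eventually (Metric.ball_mem_nhds c one_pos)).exists_forall_of_atTop
  refine ⟨max (|c| + 1) (F U + G U), fun u ↦ ?_⟩
  rcases le_total U u with hu | hu
  · refine le_max_of_le_left ?_
    have h1 := hU u hu
    rw [Real.dist_eq] at h1
    have h2 := abs_sub_abs_le_abs_sub (F u - G u) c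
    linarith
  · refine le_max_of_le_right ?_
    have := hF hu
    have := hG hu
    have := hF0 u
    have := hG0 u
    rw [abs_le]
    constructor <;> linarith

open Filter MeasureTheory in
lemma eq_eulerMascheroniConstant_of_tendsto {B : ℝ}
    (hB : Tendsto (fun n : ℕ ↦ ∑ k ∈ range (n + 1), logEulerFactor k - Real.log (Real.log n))
      atTop (nhds B)) : B = Real.eulerMascheroniConstant := by
  set F : ℝ → ℝ := fun u ↦ ∑ k ∈ range (⌊Real.exp u⌋₊ + 1), logEulerFactor k with hF
  set G : ℝ → ℝ := fun u ↦ ∑ k ∈ range ⌊u⌋₊, ((k : ℝ) + 1)⁻¹ with hG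
  have hF0 (u : ℝ) : 0 ≤ F u := Finset.sum_nonneg fun k _ ↦ logEulerFactor_nonneg k
  have hG0 (u : ℝ) : 0 ≤ G u := Finset.sum_nonneg fun k _ ↦ by positivity
  have hFm : Monotone F := fun u v huv ↦ by
    refine Finset.sum_le_sum_of_subset_of_nonneg (range_subset_range.2 ?_)
      fun k _ _ ↦ logEulerFactor_nonneg k
    exact Nat.succ_le_succ (Nat.floor_le_floor (Real.exp_le_exp.2 huv))
  have hGm : Monotone G := fun u v huv ↦ by
    refine Finset.sum_le_sum_of_subset_of_nonneg (range_subset_range.2 (Nat.floor_le_floor huv))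
      fun k _ _ ↦ by positivity
  have hD : Tendsto (fun u ↦ F u - G u) atTop (nhds (B - Real.eulerMascheroniConstant)) := by
    have h1 := (hB.comp (tendsto_nat_floor_atTop.comp Real.tendsto_exp_atTop)).add
      tendsto_log_log_floor_exp_sub_log
    have h2 := (Real.tendsto_harmonic_sub_log.comp (tendsto_nat_floor_atTop (α := ℝ))).add
      tendsto_log_floor_sub_log
    have h3 := h1.sub h2
    rw [add_zero, add_zero] at h3
    refine h3.congr fun u ↦ ?_
    simp only [hF, hG, Function.comp_apply, harmonic]
    push_cast
    ring
  obtain ⟨M, hM⟩ := exists_abs_sub_le_of_monotone_of_tendsto hFm hGm hF0 hG0 hD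
  have hlim := tendsto_integral_comp_div_mul_exp_neg (hFm.measurable.sub hGm.measurable)
    (fun u _ ↦ hM u) hD
  have hlim2 := tendsto_tsum_logEulerFactor_add_log.sub tendsto_neg_log_one_sub_exp_neg_add_log
  rw [sub_zero] at hlim2
  have heq : (fun ε : ℝ ↦ ∫ v in Set.Ici (0 : ℝ), (F - G) (v / ε) * Real.exp (-v))
      =ᶠ[nhdsWithin 0 (Set.Ioi 0)] fun ε ↦
        (∑' n, logEulerFactor n * Real.exp (-(ε * Real.log n)) + Real.log ε) -
        (-Real.log (1 - Real.exp (-ε)) + Real.log ε) := by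
    filter_upwards [self_mem_nhdsWithin] with ε (hε : 0 < ε)
    have iF : ∫ v in Set.Ici (0 : ℝ), F (v / ε) * Real.exp (-v) =
        ∑' n, logEulerFactor n * Real.exp (-(ε * Real.log n)) := by
      rw [← integral_tsum_ite_le_mul_exp_neg hε logEulerFactor_nonneg
        (fun n ↦ Real.log_natCast_nonneg n) (summable_logEulerFactor_mul_exp hε)]
      refine setIntegral_congr_fun measurableSet_Ici fun v _ ↦ ?_
      congr 1
      rw [tsum_eq_sum (s := range (⌊Real.exp (v / ε)⌋₊ + 1))]
      · refine Finset.sum_congr rfl fun k hk ↦ ?_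
        rcases Nat.eq_zero_or_pos k with rfl | hk0
        · simp [logEulerFactor]
        rw [if_pos]
        rw [Finset.mem_range, Nat.lt_succ_iff, Nat.le_floor_iff (Real.exp_pos _).le] at hk
        exact (Real.log_le_iff_le_exp (by exact_mod_cast hk0)).2 hk
      · intro k hk
        rw [Finset.mem_range, Nat.lt_succ_iff, Nat.le_floor_iff (Real.exp_pos _).le, not_le] at hk
        rw [if_neg]
        rw [not_le]
        exact (Real.lt_log_iff_exp_lt ((Real.exp_pos _).trans hk)).2 hk
    have iG : ∫ v in Set.Ici (0 : ℝ), G (v / ε) * Real.exp (-v) =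
        -Real.log (1 - Real.exp (-ε)) := by
      rw [← (hasSum_inv_succ_mul_exp hε).tsum_eq, ← integral_tsum_ite_le_mul_exp_neg hε
        (fun n ↦ by positivity) (fun n ↦ by positivity) (hasSum_inv_succ_mul_exp hε).summable]
      refine setIntegral_congr_fun measurableSet_Ici fun v (hv : 0 ≤ v) ↦ ?_
      congr 1
      have h0 : 0 ≤ v / ε := div_nonneg hv hε.le
      rw [tsum_eq_sum (s := range ⌊v / ε⌋₊)]
      · refine Finset.sum_congr rfl fun k hk ↦ ?_
        rw [if_pos]
        rw [Finset.mem_range, ← Nat.succ_le_iff, Nat.le_floor_iff h0] at hk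
        exact_mod_cast hk
      · intro k hk
        rw [Finset.mem_range, ← Nat.succ_le_iff, Nat.le_floor_iff h0] at hk
        rw [if_neg]
        exact_mod_cast hk
    have pF : 0 < ∑' n, logEulerFactor n * Real.exp (-(ε * Real.log n)) := by
      refine (summable_logEulerFactor_mul_exp hε).tsum_pos (fun n ↦
        mul_nonneg (logEulerFactor_nonneg n) (Real.exp_pos _).le) 2 ?_
      refine mul_pos (lt_of_lt_of_le ?_ (inv_le_logEulerFactor Nat.prime_two)) (Real.exp_pos _)
      norm_num
    have pG : 0 < -Real.log (1 - Real.exp (-ε)) := by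
      rw [← (hasSum_inv_succ_mul_exp hε).tsum_eq]
      exact (hasSum_inv_succ_mul_exp hε).summable.tsum_pos (fun n ↦ by positivity) 0 (by positivity)
    have jF : IntegrableOn (fun v ↦ F (v / ε) * Real.exp (-v)) (Set.Ici 0) :=
      Integrable.of_integral_ne_zero (by rw [iF]; exact pF.ne')
    have jG : IntegrableOn (fun v ↦ G (v / ε) * Real.exp (-v)) (Set.Ici 0) :=
      Integrable.of_integral_ne_zero (by rw [iG]; exact pG.ne')
    simp only [Pi.sub_apply, sub_mul]
    rw [integral_sub jF jG, iF, iG]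
    ring
  have := tendsto_nhds_unique (hlim.congr' heq) hlim2
  linarith

lemma exists_abs_sum_logEulerFactor_sub_le :
    ∃ K : ℝ, ∀ n : ℕ, 2 ≤ n → |∑ k ∈ range (n + 1), logEulerFactor k - Real.log (Real.log n) -
      Real.eulerMascheroniConstant| ≤ K / Real.log n := by
  obtain ⟨K, hK⟩ := exists_abs_sum_logEulerFactor_mul_log_sub_log_le
  obtain ⟨B, hB⟩ := exists_abs_sum_sub_log_log_sub_le hK
  refine ⟨2 * K + 1, ?_⟩
  rw [← eq_eulerMascheroniConstant_of_tendsto (B := B) ?_]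
  · exact hB
  · rw [tendsto_iff_dist_tendsto_zero]
    refine squeeze_zero' (Filter.Eventually.of_forall fun _ ↦ dist_nonneg) ?_
      (tendsto_log_natCast_atTop.const_div_atTop (2 * K + 1))
    filter_upwards [Filter.eventually_ge_atTop 2] with n hn
    exact hB n hn

/-- The arithmetic function `n ↦ 1 / n`. -/
noncomputable def invArith : ArithmeticFunction ℝ := ⟨fun n ↦ (n : ℝ)⁻¹, by simp⟩

lemma invArith_apply (n : ℕ) : invArith n = (n : ℝ)⁻¹ := rfl

open scoped ArithmeticFunction.sigma in
/-- The Dirichlet convolution of `n ↦ 1 / n` with the divisor-counting function. -/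
noncomputable def invConvSigma : ArithmeticFunction ℝ := invArith * (σ 0 : ArithmeticFunction ℕ)

lemma isMultiplicative_invConvSigma : invConvSigma.IsMultiplicative := by
  refine ArithmeticFunction.IsMultiplicative.mul ⟨by simp [invArith_apply], fun _ ↦ ?_⟩
    ArithmeticFunction.isMultiplicative_sigma.natCast
  simp [invArith_apply, mul_comm]

lemma invConvSigma_apply (n : ℕ) :
    invConvSigma n = ∑ k ∈ n.divisors, (k : ℝ)⁻¹ * ((n / k).divisors.card : ℝ) := by
  rw [invConvSigma, ArithmeticFunction.mul_apply]
  simp only [invArith_apply, ArithmeticFunction.natCoe_apply, ArithmeticFunction.sigma_zero_apply]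
  exact Nat.sum_divisorsAntidiagonal fun k m : ℕ ↦ (k : ℝ)⁻¹ * (m.divisors.card : ℝ)

lemma invConvSigma_prime_pow {p b : ℕ} (hp : p.Prime) (hb : 1 ≤ b) :
    invConvSigma (p ^ (b - 1)) = ∑ j ∈ range b, ((p : ℝ)⁻¹) ^ j * ((b : ℝ) - j) := by
  rw [invConvSigma_apply, Nat.sum_divisors_prime_pow hp, Nat.sub_add_cancel hb]
  refine sum_congr rfl fun j hj ↦ ?_
  have hj := mem_range.mp hj
  rw [Nat.pow_div (by omega) hp.pos, Nat.divisors_prime_pow hp, card_map, card_range,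
    show b - 1 - j + 1 = b - j by omega, Nat.cast_sub hj.le]
  simp

lemma card_filter_dvd_divisors {k n : ℕ} (hk : k ∣ n) (hn : n ≠ 0) :
    (n.divisors.filter (k ∣ ·)).card = (n / k).divisors.card := by
  obtain ⟨m, rfl⟩ := hk
  have hk : 0 < k := Nat.pos_of_ne_zero (left_ne_zero_of_mul hn)
  rw [Nat.mul_div_cancel_left _ hk]
  refine (card_nbij' (k * ·) (· / k) ?_ ?_ ?_ ?_).symm
  · intro a ha
    have ha := Nat.dvd_of_mem_divisors (mem_coe.mp ha)
    simp only [coe_filter, Nat.mem_divisors, Set.mem_ofPred_eq]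
    exact ⟨⟨mul_dvd_mul_left k ha, hn⟩, dvd_mul_right _ _⟩
  · intro a ha
    simp only [coe_filter, Nat.mem_divisors, Set.mem_ofPred_eq] at ha
    obtain ⟨⟨h1, -⟩, c, rfl⟩ := ha
    simp only [Nat.mul_div_cancel_left _ hk, mem_coe, Nat.mem_divisors]
    exact ⟨(Nat.mul_dvd_mul_iff_left hk).mp h1, right_ne_zero_of_mul hn⟩
  · intro a _
    exact Nat.mul_div_cancel_left _ hk
  · intro a ha
    simp only [coe_filter, Set.mem_ofPred_eq] at ha
    exact Nat.mul_div_cancel' ha.2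

lemma sum_inv_mul_card_filter_dvd {q r : ℕ} (hqr : q.Coprime r) (hq : q ≠ 0) (hr : r ≠ 0) :
    ∑ k ∈ q.divisors, (1 / (k : ℝ)) * (((q * r).divisors.filter (k ∣ ·)).card : ℝ) =
      r.divisors.card * invConvSigma q := by
  rw [invConvSigma_apply, mul_sum]
  refine sum_congr rfl fun k hk ↦ ?_
  have hkq := Nat.dvd_of_mem_divisors hk
  rw [card_filter_dvd_divisors (hkq.mul_right r) (mul_ne_zero hq hr), Nat.mul_div_right_comm hkq,
    Nat.Coprime.card_divisors_mul (hqr.of_dvd_left (Nat.div_dvd_of_dvd hkq))]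
  push_cast
  ring

lemma one_sub_mul_sum_pow_mul (t : ℝ) (b : ℕ) :
    (1 - t) * ∑ j ∈ range b, t ^ j * ((b : ℝ) - j) = b - ∑ j ∈ range b, t ^ (j + 1) := by
  induction b with
  | zero => simp
  | succ b ih =>
    have h : ∑ j ∈ range (b + 1), t ^ j * (((b + 1 : ℕ) : ℝ) - j) =
        ∑ j ∈ range b, t ^ j * ((b : ℝ) - j) + ∑ j ∈ range (b + 1), t ^ j := by
      rw [sum_range_succ, sum_range_succ (fun j ↦ t ^ j), ← add_assoc, ← sum_add_distrib]
      push_cast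
      congr 1
      · exact sum_congr rfl fun j _ ↦ by ring
      · ring
    have hg := geom_sum_mul t (b + 1)
    rw [h, mul_add, ih, sum_range_succ (fun j ↦ t ^ (j + 1))]
    push_cast
    linear_combination -hg

lemma one_sub_sum_le_prod_one_sub {ι : Type*} (s : Finset ι) {u : ι → ℝ} (h0 : ∀ i ∈ s, 0 ≤ u i)
    (h1 : ∀ i ∈ s, u i ≤ 1) : 1 - ∑ i ∈ s, u i ≤ ∏ i ∈ s, (1 - u i) := by
  classical
  induction s using Finset.induction_on with
  | empty => simp
  | insert a s ha ih =>
    have ih := ih (fun i hi ↦ h0 i (mem_insert_of_mem hi)) fun i hi ↦ h1 i (mem_insert_of_mem hi)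
    have hle : ∏ i ∈ s, (1 - u i) ≤ 1 := prod_le_one
      (fun i hi ↦ by linarith [h1 i (mem_insert_of_mem hi)])
      (fun i hi ↦ by linarith [h0 i (mem_insert_of_mem hi)])
    rw [sum_insert ha, prod_insert ha]
    nlinarith [h0 a (mem_insert_self a s)]

/-- The local factor of `invConvSigma / σ 0` at `p ^ (b - 1)`, relative to `(1 - 1 / p)⁻¹`. -/
lemma exists_invConvSigma_prime_pow_eq {p b : ℕ} (hp : p.Prime) (hb : 1 ≤ b) :
    ∃ u : ℝ, 0 ≤ u ∧ u ≤ 1 ∧ u ≤ 2 / b * logEulerFactor p ∧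
      invConvSigma (p ^ (b - 1)) = b * (Real.exp (logEulerFactor p) * (1 - u)) := by
  have hb' : (0 : ℝ) < b := by exact_mod_cast hb
  have ht := hp.inv_le_half
  have ht0 : (0 : ℝ) ≤ (p : ℝ)⁻¹ := by positivity
  have hl := inv_le_logEulerFactor hp
  rw [invConvSigma_prime_pow hp hb]
  have hexp : Real.exp (logEulerFactor p) = (1 - (p : ℝ)⁻¹)⁻¹ := by
    rw [logEulerFactor, if_pos hp, Real.exp_neg, Real.exp_log (by linarith)]
  have key := one_sub_mul_sum_pow_mul (p : ℝ)⁻¹ b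
  rw [hexp]
  generalize (p : ℝ)⁻¹ = t at *
  have hs : ∑ j ∈ range b, t ^ (j + 1) = t * ∑ j ∈ range b, t ^ j := by
    rw [mul_sum]; exact sum_congr rfl fun j _ ↦ by ring
  have hg := mul_neg_geom_sum t b
  have hG : ∑ j ∈ range b, t ^ j ≤ 2 := by
    have : 0 ≤ ∑ j ∈ range b, t ^ j := sum_nonneg fun j _ ↦ by positivity
    nlinarith [pow_nonneg ht0 b]
  refine ⟨(∑ j ∈ range b, t ^ (j + 1)) / b, by positivity, ?_, ?_, ?_⟩
  · rw [div_le_one hb']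
    calc ∑ j ∈ range b, t ^ (j + 1) ≤ ∑ j ∈ range b, (1 : ℝ) :=
          sum_le_sum fun j _ ↦ pow_le_one₀ ht0 (by linarith)
      _ = b := by simp
  · rw [div_mul_eq_mul_div]
    gcongr
    rw [hs]
    nlinarith
  · have : (1 - t) ≠ 0 := by linarith
    field_simp
    linarith

/-- The sum over `M_i`, as `|M| e ^ S` up to a factor close to one, where `S` is the sum of
`logEulerFactor p` over `p ≤ y`. -/
lemma exists_sum_resonatorProd_eq {x y : ℝ} (hyx : y ≤ x) {b : ℕ} (hb : 1 ≤ b) :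
    ∃ w : ℝ, w ≤ 1 ∧ 1 - 2 / b * ∑ k ∈ range (⌊y⌋₊ + 1), logEulerFactor k ≤ w ∧
      ∑ k ∈ (resonatorProd y b).divisors,
        (1 / (k : ℝ)) * (((resonatorProd x b).divisors.filter (k ∣ ·)).card : ℝ) =
      (resonatorProd x b).divisors.card *
        (Real.exp (∑ k ∈ range (⌊y⌋₊ + 1), logEulerFactor k) * w) := by
  set t := (Finset.range (⌊y⌋₊ + 1)).filter Nat.Prime with ht
  set s := (Finset.range (⌊x⌋₊ + 1)).filter Nat.Prime with hs
  have hts : t ⊆ s := filter_subset_filter _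
    (range_subset_range.mpr (Nat.succ_le_succ (Nat.floor_mono hyx)))
  have hprime : ∀ p ∈ s, p.Prime := fun p hp ↦ (mem_filter.mp hp).2
  have htprime : ∀ p ∈ t, p.Prime := fun p hp ↦ hprime p (hts hp)
  have hcop : ∀ p ∈ s, ∀ q ∈ s, p ≠ q → (p ^ (b - 1)).Coprime (q ^ (b - 1)) := fun p hp q hq h ↦
    ((Nat.coprime_primes (hprime p hp) (hprime q hq)).mpr h).pow _ _
  have hP : resonatorProd x b = resonatorProd y b * ∏ p ∈ s \ t, p ^ (b - 1) := by
    rw [mul_comm]; exact (prod_sdiff hts).symm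
  have hQ0 : resonatorProd y b ≠ 0 :=
    prod_ne_zero_iff.mpr fun p hp ↦ pow_ne_zero _ (htprime p hp).ne_zero
  have hR0 : ∏ p ∈ s \ t, p ^ (b - 1) ≠ 0 :=
    prod_ne_zero_iff.mpr fun p hp ↦ pow_ne_zero _ (hprime p (mem_sdiff.mp hp).1).ne_zero
  have hQR : (resonatorProd y b).Coprime (∏ p ∈ s \ t, p ^ (b - 1)) := by
    refine Nat.Coprime.prod_left fun p hp ↦ Nat.Coprime.prod_right fun q hq ↦
      hcop p (hts hp) q (mem_sdiff.mp hq).1 ?_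
    rintro rfl
    exact (mem_sdiff.mp hq).2 hp
  have hpair : (t : Set ℕ).Pairwise (Function.onFun Nat.Coprime fun p ↦ p ^ (b - 1)) :=
    fun p hp q hq h ↦ hcop p (hts hp) q (hts hq) h
  have hQcard : ((resonatorProd y b).divisors.card : ℝ) = ∏ p ∈ t, (b : ℝ) := by
    rw [← ArithmeticFunction.sigma_zero_apply, resonatorProd,
      ArithmeticFunction.isMultiplicative_sigma.map_prod _ _ hpair, Nat.cast_prod]
    refine prod_congr rfl fun p hp ↦ ?_
    rw [ArithmeticFunction.sigma_zero_apply_prime_pow (htprime p hp), Nat.sub_add_cancel hb]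
  have hsum : ∑ k ∈ range (⌊y⌋₊ + 1), logEulerFactor k = ∑ p ∈ t, logEulerFactor p := by
    rw [ht, sum_filter]
    exact sum_congr rfl fun k _ ↦ by simp only [logEulerFactor]; split_ifs <;> rfl
  choose! u hu0 hu1 hu2 hu using fun p (hp : p ∈ t) ↦
    exists_invConvSigma_prime_pow_eq (htprime p hp) hb
  refine ⟨∏ p ∈ t, (1 - u p), prod_le_one (fun p hp ↦ by linarith [hu1 p hp])
    fun p hp ↦ by linarith [hu0 p hp], ?_, ?_⟩
  · refine le_trans ?_ (one_sub_sum_le_prod_one_sub t hu0 hu1)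
    rw [hsum, mul_sum]
    exact sub_le_sub_left (sum_le_sum hu2) 1
  · rw [hP, sum_inv_mul_card_filter_dvd hQR hQ0 hR0, hQR.card_divisors_mul, Nat.cast_mul, hQcard,
      hsum, Real.exp_sum, resonatorProd, isMultiplicative_invConvSigma.map_prod _ _ hpair,
      prod_congr rfl hu, prod_mul_distrib, prod_mul_distrib]
    ring

lemma abs_exp_sub_one_le_mul_exp_abs (r : ℝ) : |Real.exp r - 1| ≤ |r| * Real.exp |r| := by
  have h1 := Real.add_one_le_exp r
  have h2 := Real.add_one_le_exp (-r)
  have h3 : Real.exp (-r) * Real.exp r = 1 := by rw [← Real.exp_add]; simp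
  have hpos := Real.exp_pos r
  rcases le_total 0 r with h | h
  · rw [abs_of_nonneg h, abs_of_nonneg (by linarith)]
    nlinarith
  · have h4 := Real.one_le_exp (abs_nonneg r)
    have h5 : Real.exp r ≤ 1 := Real.exp_le_one_iff.mpr h
    rw [abs_of_nonpos (by linarith)]
    nlinarith [abs_nonneg r, abs_of_nonpos h]

lemma abs_exp_sum_logEulerFactor_sub_le {K : ℝ} (hK : ∀ n : ℕ, 2 ≤ n →
    |∑ k ∈ range (n + 1), logEulerFactor k - Real.log (Real.log n) -
      Real.eulerMascheroniConstant| ≤ K / Real.log n) {n : ℕ} (hn : 2 ≤ n) :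
    |Real.exp (∑ k ∈ range (n + 1), logEulerFactor k) -
      Real.exp Real.eulerMascheroniConstant * Real.log n| ≤
      Real.exp Real.eulerMascheroniConstant * (K * Real.exp (K / Real.log 2)) := by
  have h2 : 0 < Real.log 2 := Real.log_pos one_lt_two
  have hn2 : Real.log 2 ≤ Real.log n := Real.log_le_log two_pos (by exact_mod_cast hn)
  have hn0 : 0 < Real.log n := h2.trans_le hn2
  have hr := hK n hn
  have hK0 : 0 ≤ K := by
    by_contra! h
    exact (((abs_nonneg _).trans hr).trans_lt (div_neg_of_neg_of_pos h hn0)).false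
  set r := ∑ k ∈ range (n + 1), logEulerFactor k - Real.log (Real.log n) -
      Real.eulerMascheroniConstant with hrdef
  have hS : Real.exp (∑ k ∈ range (n + 1), logEulerFactor k) =
      Real.exp Real.eulerMascheroniConstant * Real.log n * Real.exp r := by
    rw [show ∑ k ∈ range (n + 1), logEulerFactor k =
      Real.eulerMascheroniConstant + Real.log (Real.log n) + r by rw [hrdef]; ring,
      Real.exp_add, Real.exp_add, Real.exp_log hn0]
  rw [hS, show Real.exp Real.eulerMascheroniConstant * Real.log n * Real.exp r -
    Real.exp Real.eulerMascheroniConstant * Real.log n =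
    Real.exp Real.eulerMascheroniConstant * (Real.log n * (Real.exp r - 1)) by ring, abs_mul,
    abs_of_pos (Real.exp_pos _), abs_mul, abs_of_pos hn0]
  refine mul_le_mul_of_nonneg_left ?_ (Real.exp_pos _).le
  calc Real.log n * |Real.exp r - 1| ≤ Real.log n * (|r| * Real.exp |r|) := by
        gcongr; exact abs_exp_sub_one_le_mul_exp_abs r
    _ ≤ Real.log n * (K / Real.log n * Real.exp (K / Real.log 2)) := by
        gcongr
        exact hr.trans (div_le_div_of_nonneg_left hK0 h2 hn2)
    _ = K * Real.exp (K / Real.log 2) := by field_simp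

lemma sum_logEulerFactor_floor_eq_zero {y : ℝ} (hy : y < 2) :
    ∑ k ∈ range (⌊y⌋₊ + 1), logEulerFactor k = 0 := by
  refine sum_eq_zero fun k hk ↦ if_neg fun hp ↦ ?_
  have : ⌊y⌋₊ < 2 := Nat.floor_lt' two_ne_zero |>.mpr (by exact_mod_cast hy)
  have := mem_range.mp hk
  have := hp.two_le
  omega

/-- Mertens' product theorem with a bounded error term. -/
lemma exists_abs_exp_sum_logEulerFactor_floor_sub_le :
    ∃ K : ℝ, ∀ y : ℝ, 1 ≤ y → |Real.exp (∑ k ∈ range (⌊y⌋₊ + 1), logEulerFactor k) -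
      Real.exp Real.eulerMascheroniConstant * Real.log y| ≤ K := by
  obtain ⟨K, hK⟩ := exists_abs_sum_logEulerFactor_sub_le
  set E := Real.exp Real.eulerMascheroniConstant
  have hE : 0 < E := Real.exp_pos _
  have h2 : 0 < Real.log 2 := Real.log_pos one_lt_two
  refine ⟨max (1 + E * Real.log 2) (E * (K * Real.exp (K / Real.log 2)) + E * Real.log 2),
    fun y hy ↦ ?_⟩
  have hy0 : 0 ≤ Real.log y := Real.log_nonneg hy
  rcases lt_or_ge y 2 with h | h
  · refine le_max_of_le_left ?_
    rw [sum_logEulerFactor_floor_eq_zero h, Real.exp_zero]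
    have : Real.log y ≤ Real.log 2 := Real.log_le_log (by linarith) h.le
    rw [abs_le]
    constructor <;> nlinarith [mul_nonneg hE.le hy0, mul_nonneg hE.le h2.le]
  · refine le_max_of_le_right ?_
    have hn : 2 ≤ ⌊y⌋₊ := Nat.le_floor (by exact_mod_cast h)
    have hnR : (2 : ℝ) ≤ ⌊y⌋₊ := by exact_mod_cast hn
    have h3 : Real.log ⌊y⌋₊ ≤ Real.log y :=
      Real.log_le_log (by linarith) (Nat.floor_le (by linarith))
    have h4 : Real.log y ≤ Real.log 2 + Real.log ⌊y⌋₊ := by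
      rw [← Real.log_mul two_ne_zero (by linarith)]
      exact Real.log_le_log (by linarith) (by linarith [Nat.lt_floor_add_one y])
    have h5 := abs_exp_sum_logEulerFactor_sub_le hK hn
    refine (abs_sub_le _ (E * Real.log ⌊y⌋₊) _).trans (add_le_add h5 ?_)
    rw [← mul_sub, abs_mul, abs_of_pos hE, abs_sub_comm, abs_of_nonneg (by linarith)]
    gcongr
    linarith

lemma log_log_three_pos : 0 < Real.log (Real.log 3) :=
  Real.log_pos <| by
    rw [Real.lt_log_iff_exp_lt (by norm_num)]
    linarith [Real.exp_one_lt_d9]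

lemma exists_sum_logEulerFactor_floor_le_mul_log_log :
    ∃ K : ℝ, ∀ x : ℝ, 3 ≤ x →
      ∑ k ∈ range (⌊x⌋₊ + 1), logEulerFactor k ≤ K * Real.log (Real.log x) := by
  obtain ⟨K, hK⟩ := exists_abs_sum_logEulerFactor_sub_le
  have hl3 : 0 < Real.log 3 := Real.log_pos (by norm_num)
  have hll := log_log_three_pos
  set B := |K| / Real.log 3 + Real.eulerMascheroniConstant with hB
  have hB0 : 0 ≤ B :=
    add_nonneg (by positivity) (by linarith [Real.one_half_lt_eulerMascheroniConstant])
  refine ⟨1 + B / Real.log (Real.log 3), fun x hx ↦ ?_⟩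
  have hn : 3 ≤ ⌊x⌋₊ := Nat.le_floor (by exact_mod_cast hx)
  have hnR : (3 : ℝ) ≤ ⌊x⌋₊ := by exact_mod_cast hn
  have h1 : Real.log 3 ≤ Real.log ⌊x⌋₊ := Real.log_le_log (by norm_num) hnR
  have h2 : Real.log ⌊x⌋₊ ≤ Real.log x :=
    Real.log_le_log (by linarith) (Nat.floor_le (by linarith))
  have h3 : Real.log (Real.log ⌊x⌋₊) ≤ Real.log (Real.log x) :=
    Real.log_le_log (hl3.trans_le h1) h2
  have h4 : Real.log (Real.log 3) ≤ Real.log (Real.log x) :=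
    Real.log_le_log hl3 (h1.trans h2)
  have h5 : K / Real.log ⌊x⌋₊ ≤ |K| / Real.log 3 :=
    div_le_div₀ (abs_nonneg K) (le_abs_self K) hl3 h1
  have h6 := (abs_le.mp (hK ⌊x⌋₊ (by omega))).2
  have h7 : B ≤ B / Real.log (Real.log 3) * Real.log (Real.log x) := by
    rw [div_mul_eq_mul_div, le_div_iff₀ hll]
    exact mul_le_mul_of_nonneg_left h4 hB0
  linarith

/-- asymptotic evaluation of `Σ_{k ∈ M_i} (1/k) · #{m ∈ M : k ∣ m}`. -/
theorem sum_over_Mi_asymptotic :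
    ∃ C : ℝ, 0 < C ∧ ∀ x : ℝ, 3 ≤ x → ∀ b J i : ℕ, 1 ≤ b → 1 ≤ J → 1 ≤ i → i ≤ J →
      |(∑ k ∈ (resonatorProd (x ^ ((i : ℝ) / (J : ℝ))) b).divisors,
            (1 / (k : ℝ)) *
              ((resonatorProd x b).divisors.filter (fun m => k ∣ m)).card)
          - ((i : ℝ) / (J : ℝ)) * ((resonatorProd x b).divisors.card : ℝ) *
              Real.exp Real.eulerMascheroniConstant * Real.log x|
        ≤ C * (((i : ℝ) / (J : ℝ)) * ((resonatorProd x b).divisors.card : ℝ) *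
              Real.exp Real.eulerMascheroniConstant * Real.log x) *
            (Real.log (Real.log x) / (b : ℝ) + (J : ℝ) / Real.log x) := by
  obtain ⟨K, hK⟩ := exists_abs_exp_sum_logEulerFactor_floor_sub_le
  obtain ⟨A, hA⟩ := exists_sum_logEulerFactor_floor_le_mul_log_log
  set E := Real.exp Real.eulerMascheroniConstant with hE
  have hE1 : 1 ≤ E := Real.one_le_exp (by linarith [Real.one_half_lt_eulerMascheroniConstant])
  have hK0 : 0 ≤ K := (abs_nonneg _).trans (hK 1 le_rfl)
  have hl2 : 0 < Real.log 2 := Real.log_pos one_lt_two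
  set D := E + K / Real.log 2 with hD
  have hD0 : 0 < D := by positivity
  refine ⟨K + 2 * D * |A| + 1, by positivity, fun x hx b J i hb hJ hi hiJ ↦ ?_⟩
  have hbR : (0 : ℝ) < b := by exact_mod_cast hb
  have hJR : (0 : ℝ) < J := by exact_mod_cast hJ
  have hiR : (1 : ℝ) ≤ i := by exact_mod_cast hi
  have hlx : 0 < Real.log x := Real.log_pos (by linarith)
  have hllx : 0 < Real.log (Real.log x) := log_log_three_pos.trans_le <|
    Real.log_le_log (Real.log_pos (by norm_num)) (Real.log_le_log (by norm_num) hx)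
  set y := x ^ ((i : ℝ) / (J : ℝ)) with hy
  have hy1 : 1 ≤ y := Real.one_le_rpow (by linarith) (by positivity)
  have hyx : y ≤ x := (Real.rpow_le_rpow_of_exponent_le (by linarith)
    ((div_le_one hJR).mpr (by exact_mod_cast hiJ))).trans_eq (Real.rpow_one x)
  have hly : Real.log y = (i : ℝ) / J * Real.log x := Real.log_rpow (by linarith) _
  have hly0 : 0 ≤ Real.log y := Real.log_nonneg hy1
  obtain ⟨w, hw1, hw2, hw⟩ := exists_sum_resonatorProd_eq hyx hb
  rw [hw]
  set N := ((resonatorProd x b).divisors.card : ℝ)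
  have hN : 0 ≤ N := Nat.cast_nonneg _
  set S := ∑ k ∈ range (⌊y⌋₊ + 1), logEulerFactor k with hS
  have hS0 : 0 ≤ S := sum_nonneg fun k _ ↦ logEulerFactor_nonneg k
  have hSx : S ≤ |A| * Real.log (Real.log x) :=
    (sum_le_sum_of_subset_of_nonneg
      (range_subset_range.mpr (Nat.succ_le_succ (Nat.floor_mono hyx)))
      fun k _ _ ↦ logEulerFactor_nonneg k).trans
      ((hA x hx).trans (mul_le_mul_of_nonneg_right (le_abs_self A) hllx.le))
  have hKy := hK y hy1
  have hexpS : Real.exp S * S ≤ D * Real.log y * S := by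
    rcases lt_or_ge y 2 with h | h
    · simp [hS, sum_logEulerFactor_floor_eq_zero h]
    · have : Real.log 2 ≤ Real.log y := Real.log_le_log two_pos h
      have : K ≤ K / Real.log 2 * Real.log y := by
        rw [div_mul_eq_mul_div, le_div_iff₀ hl2]
        exact mul_le_mul_of_nonneg_left this hK0
      refine mul_le_mul_of_nonneg_right ?_ hS0
      linarith [(abs_le.mp hKy).2]
  have hmain : |Real.exp S * w - E * Real.log y| ≤
      K + 2 * D * |A| * (Real.log y * (Real.log (Real.log x) / b)) := by
    have h1 : |Real.exp S * w - Real.exp S| ≤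
        2 * D * |A| * (Real.log y * (Real.log (Real.log x) / b)) := by
      rw [abs_sub_comm, abs_of_nonneg (by nlinarith [Real.exp_pos S])]
      calc Real.exp S - Real.exp S * w = Real.exp S * (1 - w) := by ring
        _ ≤ Real.exp S * (2 / b * S) :=
            mul_le_mul_of_nonneg_left (by linarith) (Real.exp_pos S).le
        _ = 2 / b * (Real.exp S * S) := by ring
        _ ≤ 2 / b * (D * Real.log y * (|A| * Real.log (Real.log x))) := by
            refine mul_le_mul_of_nonneg_left (hexpS.trans ?_) (by positivity)
            exact mul_le_mul_of_nonneg_left hSx (by positivity)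
        _ = _ := by ring
    linarith [abs_sub_le (Real.exp S * w) (Real.exp S) (E * Real.log y)]
  have hone : 1 ≤ Real.log y * (J / Real.log x) := by
    rw [hly]
    field_simp
    exact hiR
  rw [show N * (Real.exp S * w) - (i : ℝ) / J * N * E * Real.log x =
    N * (Real.exp S * w - E * Real.log y) by rw [hly]; ring, abs_mul, abs_of_nonneg hN,
    show (K + 2 * D * |A| + 1) * ((i : ℝ) / J * N * E * Real.log x) *
      (Real.log (Real.log x) / b + J / Real.log x) = N * ((K + 2 * D * |A| + 1) * E *
      (Real.log y * (Real.log (Real.log x) / b) + Real.log y * (J / Real.log x))) by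
      rw [hly]; ring]
  refine mul_le_mul_of_nonneg_left (hmain.trans ?_) hN
  set U := Real.log y * (Real.log (Real.log x) / b)
  set V := Real.log y * (J / Real.log x)
  have hU : 0 ≤ U := by positivity
  have hDA : 0 ≤ 2 * D * |A| := by positivity
  calc K + 2 * D * |A| * U ≤ (K + 2 * D * |A| + 1) * (U + V) := by nlinarith
    _ ≤ (K + 2 * D * |A| + 1) * E * (U + V) := by
        refine mul_le_mul_of_nonneg_right ?_ (by linarith)
        exact le_mul_of_one_le_right (by linarith) hE1
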